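/- arXiv:2406.10915 — 9 statements merged into one kernel-verified Lean document; each statement's English description precedes it below -/
import Mathlib

section
/- Let d ≥ 1. There exists a constant C_d > 0 depending only on d such that for every n ≥ 1, every choice of exponents 0 < η_1 ≤ η_2 ≤ … ≤ η_n and every choice of points r_1, …, r_n ∈ ℝ^d, one has ∫_{ℝ^d} exp( − ∑_{l=1}^n η_l |x − r_l| ) dx ≤ C_d · η_n^{−d} · exp( −(η_1/4) [ |r_1−r_2| + |r_2−r_3| + … + |r_{n−1}−r_n| + |r_n−r_1| ] ). -/
open scoped BigOperators
open MeasureTheory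

/-- The exponential of a negative multiple of the norm is integrable on a Euclidean space. -/
lemma integrable_exp_neg_mul_norm {d : ℕ} (hd : 1 ≤ d) {b : ℝ} (hb : 0 < b) :
    Integrable (fun x : EuclideanSpace ℝ (Fin d) => Real.exp (-(b * ‖x‖))) := by
  have : Nontrivial (EuclideanSpace ℝ (Fin d)) := by
    apply Module.nontrivial_of_finrank_pos (R := ℝ)
    rwa [finrank_euclideanSpace_fin]
  rw [integrable_fun_norm_addHaar volume (f := fun y => Real.exp (-(b * y)))]
  have h := integrableOn_rpow_mul_exp_neg_mul_rpow (p := 1) (s := ((d - 1 : ℕ) : ℝ))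
    (by have : (0 : ℝ) ≤ ((d - 1 : ℕ) : ℝ) := by positivity
        linarith) zero_lt_one hb
  simpa [Real.rpow_natCast] using h

/-- A closed polygon is at most twice as long as the total distance of its vertices to a point. -/
lemma sum_norm_sub_cyclic_le {E : Type*} [SeminormedAddCommGroup E] {n : ℕ}
    (r : Fin (n + 1) → E) (x : E) :
    ∑ i, ‖r i - r (i + 1)‖ ≤ 2 * ∑ i, ‖x - r i‖ := by
  have hshift : ∑ i, ‖x - r (i + 1)‖ = ∑ i, ‖x - r i‖ :=
    Equiv.sum_comp (Equiv.addRight (1 : Fin (n + 1))) fun i => ‖x - r i‖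
  calc ∑ i, ‖r i - r (i + 1)‖ ≤ ∑ i, (‖x - r i‖ + ‖x - r (i + 1)‖) := by
        gcongr with i
        rw [norm_sub_rev x (r i)]
        simpa using norm_add_le (r i - x) (x - r (i + 1))
    _ = 2 * ∑ i, ‖x - r i‖ := by rw [Finset.sum_add_distrib, hshift, two_mul]

/-- For every dimension `d ≥ 1` there is a constant `C_d > 0` such that for
every `n ≥ 1` (here `n + 1` points), every nondecreasing family of positive exponents
`η 0 ≤ η 1 ≤ … ≤ η n` and all points `r 0, …, r n ∈ ℝ^d`,
`∫ exp(−∑ l, η l * ‖x − r l‖) dx ≤ C_d * (η n)^{−d} * exp(−(η 0 / 4) * cycle length)`,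
where the cycle length is `∑ i, ‖r i − r (i+1)‖` with `i + 1` cyclic in `Fin (n+1)`. -/
theorem integral_exp_sum_dist_le (d : ℕ) (hd : 1 ≤ d) :
    ∃ C > (0 : ℝ), ∀ (n : ℕ) (η : Fin (n + 1) → ℝ), Monotone η → (∀ l, 0 < η l) →
      ∀ r : Fin (n + 1) → EuclideanSpace ℝ (Fin d),
        (∫ x : EuclideanSpace ℝ (Fin d), Real.exp (-(∑ l, η l * ‖x - r l‖)))
          ≤ C * ((η (Fin.last n)) ^ d)⁻¹ *
            Real.exp (-(η 0 / 4) * ∑ i : Fin (n + 1), ‖r i - r (i + 1)‖) := by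
  refine ⟨∫ x : EuclideanSpace ℝ (Fin d), Real.exp (-(1 / 2 * ‖x‖)),
    integral_exp_pos (integrable_exp_neg_mul_norm hd (by norm_num)), fun n η hmono hpos r => ?_⟩
  set m := η (Fin.last n)
  set L := ∑ i, ‖r i - r (i + 1)‖
  have hm : 0 < m := hpos _
  have hint : Integrable fun x : EuclideanSpace ℝ (Fin d) =>
      Real.exp (-(m / 2 * ‖x - r (Fin.last n)‖)) :=
    (integrable_exp_neg_mul_norm hd (half_pos hm)).comp_sub_right (r (Fin.last n))
  have hscale : ∫ x, Real.exp (-(m / 2 * ‖x - r (Fin.last n)‖)) =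
      (∫ x : EuclideanSpace ℝ (Fin d), Real.exp (-(1 / 2 * ‖x‖))) * (m ^ d)⁻¹ := by
    rw [integral_sub_right_eq_self (fun x => Real.exp (-(m / 2 * ‖x‖)))]
    have h := Measure.integral_comp_smul (volume : Measure (EuclideanSpace ℝ (Fin d)))
      (fun x => Real.exp (-(1 / 2 * ‖x‖))) m
    rw [finrank_euclideanSpace_fin, abs_of_pos (by positivity), smul_eq_mul, mul_comm] at h
    rw [← h]
    congr 1 with x
    rw [norm_smul, Real.norm_of_nonneg hm.le]
    ring_nf
  have hbound (x : EuclideanSpace ℝ (Fin d)) : Real.exp (-(∑ l, η l * ‖x - r l‖)) ≤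
      Real.exp (-(m / 2 * ‖x - r (Fin.last n)‖)) * Real.exp (-(η 0 / 4) * L) := by
    rw [← Real.exp_add]
    have hlast : m * ‖x - r (Fin.last n)‖ ≤ ∑ l, η l * ‖x - r l‖ :=
      Finset.single_le_sum (f := fun l => η l * ‖x - r l‖)
        (fun l _ => mul_nonneg (hpos l).le (norm_nonneg _)) (Finset.mem_univ _)
    have hmin : η 0 * ∑ l, ‖x - r l‖ ≤ ∑ l, η l * ‖x - r l‖ := by
      rw [Finset.mul_sum]
      gcongr with l
      exact hmono (Fin.zero_le l)
    have hL := mul_le_mul_of_nonneg_left (sum_norm_sub_cyclic_le r x) (hpos 0).le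
    gcongr
    linarith
  calc ∫ x, Real.exp (-(∑ l, η l * ‖x - r l‖))
      ≤ ∫ x, Real.exp (-(m / 2 * ‖x - r (Fin.last n)‖)) * Real.exp (-(η 0 / 4) * L) :=
        integral_mono_of_nonneg (.of_forall fun _ => (Real.exp_pos _).le) (hint.mul_const _)
          (.of_forall hbound)
    _ = _ := by rw [integral_mul_const, hscale]
end

section
/- Let d ≥ 1. There exists a constant C_d > 0 depending only on d such that the following holds. Let 0 < η_1 ≤ η_2, let M ≥ 2 and let r_1, …, r_M ∈ ℝ^d be points with minimal separation 𝔪 := min_{i ≠ j} |r_i − r_j| > 0. Then ∑_{m=1}^M exp( −[ η_1 |r_1 − r_m| + η_2 |r_m − r_2| ] ) ≤ C_d · ( 1 + (η_2 𝔪)^{−d} ) · exp( −(η_1/2) |r_1 − r_2| ). -/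
open scoped BigOperators

open MeasureTheory Module in
/-- The function `x ↦ exp (-‖x‖ / 2)` is integrable on a finite-dimensional space. -/
theorem integrable_exp_neg_half_norm {E : Type*} [NormedAddCommGroup E] [NormedSpace ℝ E]
    [FiniteDimensional ℝ E] [MeasurableSpace E] [BorelSpace E] (μ : Measure E)
    [μ.IsAddHaarMeasure] : Integrable (fun x : E => Real.exp (-(‖x‖ / 2))) μ := by
  set k := finrank ℝ E + 1 with hk
  have hr : (finrank ℝ E : ℝ) < (k : ℝ) := by simp [hk]
  refine ((integrable_one_add_norm (μ := μ) hr).const_mul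
    (Real.exp (1 / 2) * 2 ^ k * k.factorial)).mono' (by fun_prop) (.of_forall fun x => ?_)
  have h := Real.pow_div_factorial_le_exp (x := (1 + ‖x‖) / 2) (by positivity) k
  have hs : Real.exp ((1 + ‖x‖) / 2) = Real.exp (1 / 2) * Real.exp (‖x‖ / 2) := by
    rw [← Real.exp_add]; ring_nf
  rw [hs, div_pow, div_div, div_le_iff₀ (by positivity)] at h
  rw [Real.norm_of_nonneg (Real.exp_pos _).le, Real.exp_neg, Real.rpow_neg (by positivity),
    Real.rpow_natCast, ← div_eq_mul_inv, le_div_iff₀ (by positivity),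
    inv_mul_le_iff₀ (Real.exp_pos _)]
  linarith

open MeasureTheory Module in
/-- A sum of `exp (-‖x‖ / 2)` over a `δ`-separated family is at most a constant times
`1 + δ⁻ᵈ`, where `d` is the dimension of the space. -/
theorem exists_sum_exp_neg_half_norm_le (E : Type*) [NormedAddCommGroup E] [NormedSpace ℝ E]
    [FiniteDimensional ℝ E] :
    ∃ C > (0 : ℝ), ∀ (ι : Type) [Fintype ι] (s : ι → E) (δ : ℝ), 0 < δ →
      (∀ i j, i ≠ j → δ ≤ ‖s i - s j‖) →
      ∑ i, Real.exp (-(‖s i‖ / 2)) ≤ C * (1 + (δ ^ finrank ℝ E)⁻¹) := by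
  borelize E
  let μ : Measure E := Measure.addHaar
  set d := finrank ℝ E
  set I := ∫ x, Real.exp (-(‖x‖ / 2)) ∂μ
  set ω := μ.real (Metric.ball 0 1) with hω
  have hint := integrable_exp_neg_half_norm μ
  have hIpos : 0 < I := integral_exp_pos hint
  have hωpos : 0 < ω :=
    ENNReal.toReal_pos (Metric.measure_ball_pos μ 0 one_pos).ne' measure_ball_lt_top.ne
  refine ⟨Real.exp (1 / 2) * I / ω * 2 ^ d, by positivity, fun ι _ s δ hδ hsep => ?_⟩
  set ρ := min (δ / 2) 1 with hρ
  have hρpos : 0 < ρ := lt_min (by positivity) one_pos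
  have hdisj : Pairwise (Function.onFun Disjoint fun i => Metric.ball (s i) ρ) := fun i j hij =>
    Metric.ball_disjoint_ball (by
      rw [dist_eq_norm]
      linarith [hsep i j hij, min_le_left (δ / 2) 1])
  have hball (i : ι) : Real.exp (-(‖s i‖ / 2)) * (ρ ^ d * ω) ≤
      Real.exp (1 / 2) * ∫ x in Metric.ball (s i) ρ, Real.exp (-(‖x‖ / 2)) ∂μ := by
    have hvol : μ.real (Metric.ball (s i) ρ) = ρ ^ d * ω := by
      rw [measureReal_def, Measure.addHaar_ball_of_pos μ _ hρpos, ENNReal.toReal_mul,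
        ENNReal.toReal_ofReal (by positivity), hω, measureReal_def]
    rw [← hvol, ← integral_const_mul]
    refine setIntegral_ge_of_const_le_real measurableSet_ball measure_ball_lt_top.ne
      (fun x hx => ?_) (hint.const_mul _).integrableOn
    rw [← Real.exp_add, Real.exp_le_exp]
    have h1 := norm_sub_norm_le x (s i)
    rw [Metric.mem_ball, dist_eq_norm] at hx
    linarith [min_le_right (δ / 2) 1]
  have hsum : (∑ i, Real.exp (-(‖s i‖ / 2))) * (ρ ^ d * ω) ≤ Real.exp (1 / 2) * I := by
    rw [Finset.sum_mul]
    refine (Finset.sum_le_sum fun i _ => hball i).trans ?_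
    rw [← Finset.mul_sum, ← integral_iUnion_fintype (fun _ => measurableSet_ball) hdisj
      (fun _ => hint.integrableOn)]
    gcongr
    exact setIntegral_le_integral hint (.of_forall fun x => (Real.exp_pos _).le)
  have hρinv : (ρ ^ d)⁻¹ ≤ 2 ^ d * (1 + (δ ^ d)⁻¹) := by
    have h2 : (1 : ℝ) ≤ 2 ^ d := one_le_pow₀ one_le_two
    have hδd : 0 < (δ ^ d)⁻¹ := by positivity
    rcases min_choice (δ / 2) 1 with h | h <;> rw [hρ, h]
    · rw [div_pow, inv_div, div_eq_mul_inv]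
      gcongr
      linarith
    · rw [one_pow, inv_one]
      nlinarith
  calc ∑ i, Real.exp (-(‖s i‖ / 2)) ≤ Real.exp (1 / 2) * I / (ρ ^ d * ω) :=
        (le_div_iff₀ (by positivity)).2 hsum
    _ = Real.exp (1 / 2) * I / ω * (ρ ^ d)⁻¹ := by field_simp
    _ ≤ Real.exp (1 / 2) * I / ω * (2 ^ d * (1 + (δ ^ d)⁻¹)) := by gcongr
    _ = _ := by ring

/-- For every dimension `d ≥ 1` there is a constant `C_d > 0` such that:
for all exponents `0 < η₁ ≤ η₂`, all `M ≥ 2` points `r 0, …, r (M+1)` in `ℝ^d` with minimal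
separation `𝔪 > 0` (i.e. `𝔪 ≤ ‖r i − r j‖` for all `i ≠ j`),
`∑ m, exp(−[η₁ ‖r 0 − r m‖ + η₂ ‖r m − r 1‖]) ≤ C_d (1 + (η₂ 𝔪)^{−d}) exp(−(η₁/2) ‖r 0 − r 1‖)`. -/
theorem sum_exp_two_center_le (d : ℕ) (hd : 1 ≤ d) :
    ∃ C > (0 : ℝ), ∀ (η₁ η₂ : ℝ), 0 < η₁ → η₁ ≤ η₂ →
      ∀ (M : ℕ) (r : Fin (M + 2) → EuclideanSpace ℝ (Fin d)) (𝔪 : ℝ), 0 < 𝔪 →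
        (∀ i j, i ≠ j → 𝔪 ≤ ‖r i - r j‖) →
        ∑ m : Fin (M + 2), Real.exp (-(η₁ * ‖r 0 - r m‖ + η₂ * ‖r m - r 1‖))
          ≤ C * (1 + ((η₂ * 𝔪) ^ d)⁻¹) * Real.exp (-(η₁ / 2) * ‖r 0 - r 1‖) := by
  obtain ⟨C, hC, h⟩ := exists_sum_exp_neg_half_norm_le (EuclideanSpace ℝ (Fin d))
  rw [finrank_euclideanSpace_fin] at h
  refine ⟨C, hC, fun η₁ η₂ hη₁ hη M r 𝔪 h𝔪 hsep => ?_⟩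
  have hη₂ : 0 < η₂ := hη₁.trans_le hη
  have hscaled := h (Fin (M + 2)) (fun m => η₂ • (r m - r 1)) (η₂ * 𝔪) (by positivity)
    (fun i j hij => by
      rw [← smul_sub, sub_sub_sub_cancel_right, norm_smul, Real.norm_of_nonneg hη₂.le]
      exact mul_le_mul_of_nonneg_left (hsep i j hij) hη₂.le)
  refine le_trans ?_ (mul_le_mul_of_nonneg_right hscaled (Real.exp_pos _).le)
  rw [Finset.sum_mul]
  refine Finset.sum_le_sum fun m _ => ?_
  rw [← Real.exp_add, Real.exp_le_exp, norm_smul, Real.norm_of_nonneg hη₂.le]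
  have htri := norm_sub_le_norm_sub_add_norm_sub (r 0) (r m) (r 1)
  nlinarith [mul_le_mul_of_nonneg_left htri hη₁.le, mul_nonneg hη₁.le (norm_nonneg (r 0 - r m)),
    mul_le_mul_of_nonneg_right hη (norm_nonneg (r m - r 1))]
end

section
/- For every η > 0 there exists a constant C > 0 (depending only on η) such that for all points a, b ∈ ℝ^3 and every x ∈ ℝ^3 with x ∉ {a, b}, one has ∫_{ℝ^3} exp( −η [ |a − y| + |y − b| ] ) / |x − y| dy ≤ C · exp( −(η/2) |a − b| ) / ( |a − x| + |x − b| ). -/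
open MeasureTheory

theorem integrable_exp_neg_mul_norm_s4 {c : ℝ} (hc : 0 < c) :
    Integrable (fun y : EuclideanSpace ℝ (Fin 3) ↦ Real.exp (-c * ‖y‖)) := by
  rw [integrable_fun_norm_addHaar volume (f := fun r ↦ Real.exp (-c * r))]
  have h := integrableOn_rpow_mul_exp_neg_mul_rpow (p := 1) (s := 2) (b := c)
    (by norm_num) (by norm_num) hc
  simpa using h

theorem integrable_indicator_ball_inv_norm :
    Integrable (fun y : EuclideanSpace ℝ (Fin 3) ↦ (Set.Iio (1 : ℝ)).indicator (·⁻¹) ‖y‖) := by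
  rw [integrable_fun_norm_addHaar volume (f := (Set.Iio (1 : ℝ)).indicator (·⁻¹))]
  have h : IntegrableOn (fun r : ℝ ↦ r) (Set.Ioo 0 1) :=
    (continuous_id.integrableOn_Icc).mono_set Set.Ioo_subset_Icc_self
  rw [← integrable_indicator_iff measurableSet_Ioo] at h
  refine h.integrableOn.congr_fun (fun r hr ↦ ?_) measurableSet_Ioi
  have hr0 : r ≠ 0 := (Set.mem_Ioi.1 hr).ne'
  by_cases h1 : r < 1
  · simp [Set.indicator, h1, Set.mem_Ioi.1 hr]
    field_simp
  · simp [Set.indicator, h1]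

theorem dist_sum_mul_exp_div_le {E : Type*} [NormedAddCommGroup E] {η : ℝ} (hη : 0 < η)
    (a b x y : E) :
    (‖a - x‖ + ‖x - b‖) * (Real.exp (-(η * (‖a - y‖ + ‖y - b‖))) / ‖x - y‖) ≤
      Real.exp (-(η / 2) * ‖a - b‖) * ((2 + 4 / η) * Real.exp (-(η / 4) * ‖y - a‖) +
        4 / η * (Set.Iio (1 : ℝ)).indicator (·⁻¹) ‖y - x‖) := by
  rw [norm_sub_rev x y, norm_sub_rev y a]
  have h1 : ‖a - b‖ ≤ ‖a - y‖ + ‖y - b‖ := norm_sub_le_norm_sub_add_norm_sub a y b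
  have h2 : ‖a - x‖ ≤ ‖a - y‖ + ‖y - x‖ := norm_sub_le_norm_sub_add_norm_sub a y x
  have h3 : ‖x - b‖ ≤ ‖y - x‖ + ‖y - b‖ := by
    simpa [norm_sub_rev x y] using norm_sub_le_norm_sub_add_norm_sub x y b
  have hr : 0 ≤ ‖y - x‖ := norm_nonneg _
  have hb : 0 ≤ ‖y - b‖ := norm_nonneg _
  have ha : 0 ≤ ‖a - y‖ := norm_nonneg _
  generalize ‖y - x‖ = r at *
  set S := ‖a - y‖ + ‖y - b‖ with hS
  set e := Real.exp (-(η / 4) * ‖a - y‖) with he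
  have hS0 : 0 ≤ S := by positivity
  have e0 : 0 < e := Real.exp_pos _
  have e1 : e ≤ 1 := Real.exp_le_one_iff.2 (by nlinarith)
  have hexp : Real.exp (-(η * S)) ≤
      Real.exp (-(η / 2) * ‖a - b‖) * Real.exp (-(η / 2) * S) := by
    rw [← Real.exp_add, Real.exp_le_exp]
    nlinarith
  have hexp_e : Real.exp (-(η / 4) * S) ≤ e := Real.exp_le_exp.2 (by nlinarith)
  have hsplit : Real.exp (-(η / 2) * S) = Real.exp (-(η / 4) * S) * Real.exp (-(η / 4) * S) := by
    rw [← Real.exp_add]; ring_nf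
  have hSe : S * Real.exp (-(η / 4) * S) ≤ 4 / η := by
    have h := Real.add_one_le_exp (η / 4 * S)
    rw [neg_mul, Real.exp_neg, ← div_eq_mul_inv, div_le_div_iff₀ (Real.exp_pos _) hη]
    nlinarith
  have hexp1 : Real.exp (-(η / 4) * S) ≤ 1 := hexp_e.trans e1
  have hq : 0 < Real.exp (-(η / 4) * S) := Real.exp_pos _
  have hA : Real.exp (-(η / 2) * S) ≤ e := by rw [hsplit]; nlinarith
  have hB : S * Real.exp (-(η / 2) * S) ≤ 4 / η * e := by
    rw [hsplit, ← mul_assoc]; gcongr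
  have hinv : e * r⁻¹ ≤ e + (Set.Iio (1 : ℝ)).indicator (·⁻¹) r := by
    by_cases hr1 : r < 1
    · rw [Set.indicator_of_mem (Set.mem_Iio.2 hr1)]
      have : 0 ≤ r⁻¹ := inv_nonneg.2 hr
      nlinarith
    · rw [Set.indicator_of_notMem (by simpa using hr1)]
      have : r⁻¹ ≤ 1 := inv_le_one_of_one_le₀ (not_lt.1 hr1)
      nlinarith
  calc (‖a - x‖ + ‖x - b‖) * (Real.exp (-(η * S)) / r)
      ≤ (2 * r + S) * (Real.exp (-(η / 2) * ‖a - b‖) * Real.exp (-(η / 2) * S) / r) := by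
        have hT : ‖a - x‖ + ‖x - b‖ ≤ 2 * r + S := by linarith
        gcongr ?_ * (?_ / _)
    _ = Real.exp (-(η / 2) * ‖a - b‖) * (2 * (r * r⁻¹) * Real.exp (-(η / 2) * S) +
          S * Real.exp (-(η / 2) * S) * r⁻¹) := by ring
    _ ≤ Real.exp (-(η / 2) * ‖a - b‖) * (2 * 1 * e + 4 / η * e * r⁻¹) := by
        gcongr
        exact mul_inv_le_one
    _ ≤ Real.exp (-(η / 2) * ‖a - b‖) * (2 * e +
          4 / η * (e + (Set.Iio (1 : ℝ)).indicator (·⁻¹) r)) := by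
        rw [mul_assoc (4 / η), mul_one]
        gcongr
    _ = _ := by ring

/-- For every `η > 0` there is `C > 0` such that for all `a, b, x ∈ ℝ³`
with `x ∉ {a, b}`:
`∫ exp(−η [‖a−y‖+‖y−b‖]) / ‖x−y‖ dy ≤ C exp(−(η/2)‖a−b‖) / (‖a−x‖+‖x−b‖)`. -/
theorem integral_exp_div_dist_le (η : ℝ) (hη : 0 < η) :
    ∃ C > (0 : ℝ), ∀ a b x : EuclideanSpace ℝ (Fin 3), x ≠ a → x ≠ b →
      (∫ y : EuclideanSpace ℝ (Fin 3),
          Real.exp (-(η * (‖a - y‖ + ‖y - b‖))) / ‖x - y‖)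
        ≤ C * Real.exp (-(η / 2) * ‖a - b‖) / (‖a - x‖ + ‖x - b‖) := by
  set g : EuclideanSpace ℝ (Fin 3) → ℝ := fun y ↦ Real.exp (-(η / 4) * ‖y‖) with hg
  set h : EuclideanSpace ℝ (Fin 3) → ℝ :=
    fun y ↦ (Set.Iio (1 : ℝ)).indicator (·⁻¹) ‖y‖ with hh
  have ig : Integrable g := integrable_exp_neg_mul_norm_s4 (by positivity)
  have ih : Integrable h := integrable_indicator_ball_inv_norm
  have g0 : 0 ≤ ∫ y, g y := integral_nonneg fun y ↦ (Real.exp_pos _).le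
  have h0 : 0 ≤ ∫ y, h y := integral_nonneg fun y ↦
    Set.indicator_apply_nonneg fun _ ↦ inv_nonneg.2 (norm_nonneg y)
  refine ⟨(2 + 4 / η) * (∫ y, g y) + 4 / η * (∫ y, h y) + 1, by positivity, ?_⟩
  intro a b x hxa _
  have hT : 0 < ‖a - x‖ + ‖x - b‖ :=
    add_pos_of_pos_of_nonneg (norm_pos_iff.2 (sub_ne_zero.2 hxa.symm)) (norm_nonneg _)
  have i1 : Integrable fun y ↦ (2 + 4 / η) * g (y - a) := (ig.comp_sub_right a).const_mul _
  have i2 : Integrable fun y ↦ 4 / η * h (y - x) := (ih.comp_sub_right x).const_mul _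
  rw [le_div_iff₀' hT, ← integral_const_mul]
  calc _ ≤ ∫ y, Real.exp (-(η / 2) * ‖a - b‖) * ((2 + 4 / η) * g (y - a) + 4 / η * h (y - x)) :=
        integral_mono_of_nonneg (.of_forall fun y ↦ by positivity) ((i1.add i2).const_mul _)
          (.of_forall fun y ↦ dist_sum_mul_exp_div_le hη a b x y)
    _ = Real.exp (-(η / 2) * ‖a - b‖) *
          ((2 + 4 / η) * (∫ y, g y) + 4 / η * (∫ y, h y)) := by
        rw [integral_const_mul, integral_add i1 i2, integral_const_mul, integral_const_mul,
          integral_sub_right_eq_self g a, integral_sub_right_eq_self h x]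
    _ ≤ _ := by
        rw [mul_comm]
        exact mul_le_mul_of_nonneg_right (by linarith) (Real.exp_pos _).le
end

section
/- For every η > 0 there exists a constant C > 0 (depending only on η) such that for every finite collection of points r_1, …, r_M ∈ ℝ^3 and every x ∈ ℝ^3 with x ∉ {r_1, …, r_M}, one has ∫_{ℝ^3} exp( −η · min_{1 ≤ m ≤ M} |y − r_m| ) / |x − y| dy ≤ C · ∑_{m=1}^M 1 / |x − r_m|. -/
open MeasureTheory
open scoped BigOperators

lemma integrable_exp_neg_mul_norm_euclideanSpace_three {b : ℝ} (hb : 0 < b) :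
    Integrable (fun y : EuclideanSpace ℝ (Fin 3) => Real.exp (-(b * ‖y‖))) := by
  rw [integrable_fun_norm_addHaar volume (f := fun t : ℝ => Real.exp (-(b * t)))]
  have h := integrableOn_rpow_mul_exp_neg_mul_rpow (p := 1) (s := 2) (b := b)
    (by norm_num) (by norm_num) hb
  refine h.congr_fun (fun t _ => ?_) measurableSet_Ioi
  simp

lemma integrable_indicator_inv_norm_euclideanSpace_three :
    Integrable (fun y : EuclideanSpace ℝ (Fin 3) =>
      (Set.Iic (1 : ℝ)).indicator (fun t => t⁻¹) ‖y‖) := by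
  rw [integrable_fun_norm_addHaar volume (f := (Set.Iic (1 : ℝ)).indicator fun t => t⁻¹)]
  have h : IntegrableOn (fun t : ℝ => t) (Set.Ioc 0 1) :=
    (continuous_id.integrableOn_Icc (a := (0 : ℝ)) (b := 1)).mono_set Set.Ioc_subset_Icc_self
  have h' := (integrable_indicator_iff measurableSet_Ioc).2 h
  refine (h'.integrableOn (s := Set.Ioi 0)).congr_fun (fun t ht => ?_) measurableSet_Ioi
  have ht : 0 < t := ht
  by_cases h1 : t ≤ 1
  · simp [Set.indicator, ht, h1]
    field_simp
  · simp [Set.indicator, h1]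

lemma mul_exp_neg_mul_le {η : ℝ} (hη : 0 < η) (t : ℝ) :
    t * Real.exp (-(η * t)) ≤ 2 / η * Real.exp (-(η / 2 * t)) := by
  have h : η / 2 * t ≤ Real.exp (η / 2 * t) := by
    linarith [Real.add_one_le_exp (η / 2 * t)]
  have h' : t ≤ 2 / η * Real.exp (η / 2 * t) := by
    calc t = 2 / η * (η / 2 * t) := by field_simp
      _ ≤ _ := by gcongr
  calc t * Real.exp (-(η * t))
      ≤ (2 / η * Real.exp (η / 2 * t)) * Real.exp (-(η * t)) := by gcongr
    _ = 2 / η * Real.exp (-(η / 2 * t)) := by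
      rw [mul_assoc, ← Real.exp_add]
      ring_nf

lemma exp_neg_norm_div_le {E : Type*} [NormedAddCommGroup E] {η : ℝ} (hη : 0 < η)
    {x r : E} (hxr : x ≠ r) (y : E) :
    Real.exp (-(η * ‖y - r‖)) / ‖x - y‖ ≤
      ((1 + 2 / η) * Real.exp (-(η / 2 * ‖y - r‖)) +
        2 / η * (Set.Iic (1 : ℝ)).indicator (fun t => t⁻¹) ‖y - x‖) * (1 / ‖x - r‖) := by
  have hd : 0 < ‖x - r‖ := norm_pos_iff.2 (sub_ne_zero.2 hxr)
  rw [mul_one_div, le_div_iff₀ hd, norm_sub_rev x y]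
  have htri : ‖x - r‖ ≤ ‖y - x‖ + ‖y - r‖ := by
    rw [norm_sub_rev y x]
    simpa using norm_add_le (x - y) (y - r)
  have hexp := mul_exp_neg_mul_le hη ‖y - r‖
  have ht : 0 ≤ ‖y - r‖ := norm_nonneg _
  generalize ‖y - r‖ = t at *
  have hs : 0 ≤ ‖y - x‖ := norm_nonneg _
  generalize ‖y - x‖ = s at *
  have hE : Real.exp (-(η * t)) ≤ Real.exp (-(η / 2 * t)) := by
    apply Real.exp_le_exp.2
    nlinarith
  have hE1 : Real.exp (-(η / 2 * t)) ≤ 1 := by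
    apply Real.exp_le_one_iff.2
    have : 0 ≤ η / 2 * t := by positivity
    linarith
  have hpos := Real.exp_pos (-(η * t))
  have hpos' := Real.exp_pos (-(η / 2 * t))
  have hinv : s⁻¹ ≤ 1 + (Set.Iic (1 : ℝ)).indicator (fun t => t⁻¹) s := by
    by_cases h1 : s ≤ 1
    · simp [Set.indicator, h1]
    · simpa [Set.indicator, h1] using inv_le_one_of_one_le₀ (not_le.1 h1).le
  have hind : 0 ≤ (Set.Iic (1 : ℝ)).indicator (fun t => t⁻¹) s :=
    Set.indicator_apply_nonneg fun _ => inv_nonneg.2 hs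
  generalize (Set.Iic (1 : ℝ)).indicator (fun t => t⁻¹) s = i at *
  have hss : s * s⁻¹ ≤ 1 := mul_inv_le_one
  have hsi : 0 ≤ s⁻¹ := inv_nonneg.2 hs
  calc Real.exp (-(η * t)) / s * ‖x - r‖
      ≤ Real.exp (-(η * t)) / s * (s + t) := by gcongr
    _ = Real.exp (-(η * t)) * (s * s⁻¹) + t * Real.exp (-(η * t)) * s⁻¹ := by
      rw [div_eq_mul_inv]; ring
    _ ≤ Real.exp (-(η / 2 * t)) * 1 + 2 / η * Real.exp (-(η / 2 * t)) * (1 + i) := by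
      gcongr
    _ = (1 + 2 / η) * Real.exp (-(η / 2 * t)) + 2 / η * (Real.exp (-(η / 2 * t)) * i) := by
      ring
    _ ≤ (1 + 2 / η) * Real.exp (-(η / 2 * t)) + 2 / η * i := by
      gcongr
      exact mul_le_of_le_one_left hind hE1

/-- For every `η > 0` there is `C > 0` such that for every finite collection
of points `r 1, …, r M ∈ ℝ³` (`M ≥ 1`) and every `x ∈ ℝ³` with `x ∉ {r 1, …, r M}`:
`∫ exp(−η minₘ ‖y − r m‖) / ‖x − y‖ dy ≤ C ∑ₘ 1 / ‖x − r m‖`. -/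
theorem integral_exp_min_div_dist_le (η : ℝ) (hη : 0 < η) :
    ∃ C > (0 : ℝ), ∀ (M : ℕ), 1 ≤ M → ∀ (r : Fin M → EuclideanSpace ℝ (Fin 3))
      (x : EuclideanSpace ℝ (Fin 3)), (∀ m, x ≠ r m) →
      (∫ y : EuclideanSpace ℝ (Fin 3),
          Real.exp (-(η * ⨅ m, ‖y - r m‖)) / ‖x - y‖)
        ≤ C * ∑ m, 1 / ‖x - r m‖ := by
  set F : EuclideanSpace ℝ (Fin 3) → ℝ := fun y => Real.exp (-(η / 2 * ‖y‖))
  set G : EuclideanSpace ℝ (Fin 3) → ℝ :=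
    fun y => (Set.Iic (1 : ℝ)).indicator (fun t => t⁻¹) ‖y‖
  have hFi : Integrable F := integrable_exp_neg_mul_norm_euclideanSpace_three (half_pos hη)
  have hGi : Integrable G := integrable_indicator_inv_norm_euclideanSpace_three
  have hF0 : 0 ≤ ∫ y, F y := integral_nonneg fun y => (Real.exp_pos _).le
  have hG0 : 0 ≤ ∫ y, G y := integral_nonneg fun y =>
    Set.indicator_apply_nonneg fun _ => inv_nonneg.2 (norm_nonneg y)
  refine ⟨(1 + 2 / η) * (∫ y, F y) + 2 / η * (∫ y, G y) + 1, by positivity,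
    fun M hM r x hx => ?_⟩
  have : Nonempty (Fin M) := ⟨⟨0, hM⟩⟩
  have hint (m : Fin M) : Integrable fun y =>
      ((1 + 2 / η) * F (y - r m) + 2 / η * G (y - x)) * (1 / ‖x - r m‖) :=
    (((hFi.comp_sub_right (r m)).const_mul _).add
      ((hGi.comp_sub_right x).const_mul _)).mul_const _
  calc (∫ y, Real.exp (-(η * ⨅ m, ‖y - r m‖)) / ‖x - y‖)
      ≤ ∫ y, ∑ m, ((1 + 2 / η) * F (y - r m) + 2 / η * G (y - x)) * (1 / ‖x - r m‖) := by
        refine integral_mono_of_nonneg (ae_of_all _ fun y => by positivity)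
          (integrable_finsetSum _ fun m _ => hint m) (ae_of_all _ fun y => ?_)
        obtain ⟨m, hm⟩ := exists_eq_ciInf_of_finite (f := fun m => ‖y - r m‖)
        have hle := Finset.single_le_sum
          (f := fun m => Real.exp (-(η * ‖y - r m‖)) / ‖x - y‖)
          (fun _ _ => by positivity) (Finset.mem_univ m)
        dsimp only at hm hle ⊢
        rw [← hm]
        exact hle.trans (Finset.sum_le_sum fun m _ => exp_neg_norm_div_le hη (hx m) y)
    _ = ∑ m, ((1 + 2 / η) * (∫ y, F y) + 2 / η * (∫ y, G y)) * (1 / ‖x - r m‖) := by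
        rw [integral_finsetSum _ fun m _ => hint m]
        refine Finset.sum_congr rfl fun m _ => ?_
        rw [integral_mul_const, integral_add ((hFi.comp_sub_right (r m)).const_mul _)
          ((hGi.comp_sub_right x).const_mul _), integral_const_mul, integral_const_mul,
          integral_sub_right_eq_self F, integral_sub_right_eq_self G]
    _ ≤ _ := by
        rw [← Finset.mul_sum]
        exact mul_le_mul_of_nonneg_right (le_add_of_nonneg_right zero_le_one)
          (Finset.sum_nonneg fun _ _ => by positivity)
end

section
/- Fix μ ∈ ℝ, real numbers σ̲ < μ − g₋ and μ + g₊ < σ̄ with g₋, g₊ > 0, and set X := [σ̲, μ − g₋] ∪ [μ + g₊, σ̄]. Let F : X → ℝ be the zero-temperature occupation function, F(x) = 1 for x ≤ μ − g₋ and F(x) = 0 for x ≥ μ + g₊. Then there exist constants θ > 0 and C > 0 such that for every N ∈ ℕ there exists a real polynomial F_N of degree at most N with sup_{x ∈ X} |F(x) − F_N(x)| ≤ C e^{−θ N}. -/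
/-- If `a ≤ b` are nonnegative with geometric mean at most `c`, then a monomial in `a` and `b`
favouring `a` is at most the corresponding power of `c`. -/
theorem pow_mul_pow_le_pow_add {a b c : ℝ} (ha : 0 ≤ a) (hab : a ≤ b) (hc : 0 ≤ c)
    (habc : a * b ≤ c ^ 2) {j k : ℕ} (hjk : j ≤ k) : a ^ k * b ^ j ≤ c ^ (k + j) := by
  obtain ⟨d, rfl⟩ := Nat.exists_eq_add_of_le hjk
  have hac : a ≤ c := by
    refine abs_le_of_sq_le_sq' ?_ hc |>.2
    nlinarith
  calc a ^ (j + d) * b ^ j = (a * b) ^ j * a ^ d := by ring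
    _ ≤ (c ^ 2) ^ j * c ^ d := by
        have := mul_nonneg ha (ha.trans hab)
        gcongr
    _ = c ^ (j + d + j) := by ring

/-- A partial sum of the binomial expansion whose monomials are at most `c ^ n` is at most
`(2 * c) ^ n`. -/
theorem sum_binomial_le_two_mul_pow {n : ℕ} {s : Finset ℕ} {f : ℕ → ℝ} {c : ℝ} (hc : 0 ≤ c)
    (hs : s ⊆ Finset.range (n + 1)) (hf : ∀ k ∈ s, f k ≤ c ^ n) :
    ∑ k ∈ s, f k * (n.choose k : ℝ) ≤ (2 * c) ^ n := by
  calc ∑ k ∈ s, f k * (n.choose k : ℝ) ≤ ∑ k ∈ s, c ^ n * (n.choose k : ℝ) :=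
        Finset.sum_le_sum fun k hk => mul_le_mul_of_nonneg_right (hf k hk) (Nat.cast_nonneg _)
    _ ≤ ∑ k ∈ Finset.range (n + 1), c ^ n * (n.choose k : ℝ) :=
        Finset.sum_le_sum_of_subset_of_nonneg hs fun _ _ _ => by positivity
    _ = (2 * c) ^ n := by
        rw [← Finset.mul_sum, mul_pow, mul_comm]
        congr 1
        exact_mod_cast Nat.sum_range_choose n

/-- The probability, as a polynomial in the success probability, that at least half of `n`
independent trials succeed. -/
noncomputable def majorityPolynomial (n : ℕ) : Polynomial ℝ :=
  ∑ k ∈ Finset.range (n + 1) with n ≤ 2 * k,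
    Polynomial.X ^ k * (1 - Polynomial.X) ^ (n - k) * (n.choose k : Polynomial ℝ)

theorem natDegree_majorityPolynomial_le (n : ℕ) : (majorityPolynomial n).natDegree ≤ n := by
  refine Polynomial.natDegree_sum_le_of_forall_le _ _ fun k hk => ?_
  have hkn : k ≤ n := by
    simp only [Finset.mem_filter, Finset.mem_range] at hk
    omega
  have hX : (1 - Polynomial.X : Polynomial ℝ).natDegree ≤ 1 := by compute_degree
  calc _ ≤ k * 1 + (n - k) * 1 + 0 :=
        Polynomial.natDegree_mul_le_of_le
          (Polynomial.natDegree_mul_le_of_le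
            (Polynomial.natDegree_pow_le_of_le k Polynomial.natDegree_X_le)
            (Polynomial.natDegree_pow_le_of_le (n - k) hX))
          (Polynomial.natDegree_natCast _).le
    _ = n := by omega

theorem eval_majorityPolynomial (n : ℕ) (t : ℝ) :
    (majorityPolynomial n).eval t =
      ∑ k ∈ Finset.range (n + 1) with n ≤ 2 * k, t ^ k * (1 - t) ^ (n - k) * (n.choose k : ℝ) := by
  simp [majorityPolynomial, Polynomial.eval_finsetSum]

theorem one_sub_eval_majorityPolynomial (n : ℕ) (t : ℝ) :
    1 - (majorityPolynomial n).eval t =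
      ∑ k ∈ Finset.range (n + 1) with ¬ n ≤ 2 * k,
        t ^ k * (1 - t) ^ (n - k) * (n.choose k : ℝ) := by
  have h := add_pow t (1 - t) n
  rw [add_sub_cancel, one_pow, ← Finset.sum_filter_add_sum_filter_not _ (fun k => n ≤ 2 * k)] at h
  rw [eval_majorityPolynomial]
  linarith

theorem abs_eval_majorityPolynomial_le {t c : ℝ} (ht : 0 ≤ t) (ht2 : t ≤ 1 / 2) (hc : 0 ≤ c)
    (h : t * (1 - t) ≤ c ^ 2) (n : ℕ) : |(majorityPolynomial n).eval t| ≤ (2 * c) ^ n := by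
  have ht1 : 0 ≤ 1 - t := by linarith
  rw [eval_majorityPolynomial, abs_of_nonneg (Finset.sum_nonneg fun _ _ => by positivity)]
  refine sum_binomial_le_two_mul_pow hc (Finset.filter_subset _ _) fun k hk => ?_
  simp only [Finset.mem_filter, Finset.mem_range] at hk
  have := pow_mul_pow_le_pow_add ht (by linarith) hc h (show n - k ≤ k by omega)
  rwa [show k + (n - k) = n by omega] at this

theorem abs_one_sub_eval_majorityPolynomial_le {t c : ℝ} (ht : 1 / 2 ≤ t) (ht1 : t ≤ 1)
    (hc : 0 ≤ c) (h : t * (1 - t) ≤ c ^ 2) (n : ℕ) :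
    |1 - (majorityPolynomial n).eval t| ≤ (2 * c) ^ n := by
  have ht0 : 0 ≤ t := by linarith
  have ht1' : 0 ≤ 1 - t := by linarith
  rw [one_sub_eval_majorityPolynomial,
    abs_of_nonneg (Finset.sum_nonneg fun _ _ => by positivity)]
  refine sum_binomial_le_two_mul_pow hc (Finset.filter_subset _ _) fun k hk => ?_
  simp only [Finset.mem_filter, Finset.mem_range] at hk
  have := pow_mul_pow_le_pow_add ht1' (show 1 - t ≤ t by linarith) hc (by rwa [mul_comm])
    (show k ≤ n - k by omega)
  rwa [show n - k + k = n by omega, mul_comm] at this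

/-- Exponentially convergent polynomial approximation of the
zero-temperature occupation (step) function on `X = [σlo, μ − gminus] ∪ [μ + gplus, σhi]`:
with `F(x) = 1` for `x ≤ μ − gminus` and `F(x) = 0` otherwise (on `X`), there are `θ > 0`
and `C > 0` such that for every `N` there is a real polynomial `p` of degree at most `N`
with `|F(x) − p(x)| ≤ C e^{−θ N}` for all `x ∈ X`. -/
theorem step_function_poly_approx (μ gminus gplus σlo σhi : ℝ)
    (hgm : 0 < gminus) (hgp : 0 < gplus)
    (h1 : σlo < μ - gminus) (h2 : μ + gplus < σhi) :
    ∃ θ > (0 : ℝ), ∃ C > (0 : ℝ), ∀ N : ℕ, ∃ p : Polynomial ℝ,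
      p.natDegree ≤ N ∧
      ∀ x ∈ Set.Icc σlo (μ - gminus) ∪ Set.Icc (μ + gplus) σhi,
        |(if x ≤ μ - gminus then (1 : ℝ) else 0) - p.eval x| ≤ C * Real.exp (-(θ * N)) := by
  obtain ⟨g, hg, hgm', hgp'⟩ : ∃ g > 0, g ≤ gminus ∧ g ≤ gplus :=
    ⟨min gminus gplus, lt_min hgm hgp, min_le_left _ _, min_le_right _ _⟩
  obtain ⟨R, hRlo, hRhi⟩ : ∃ R, μ - σlo ≤ R ∧ σhi - μ ≤ R :=
    ⟨max (μ - σlo) (σhi - μ), le_max_left _ _, le_max_right _ _⟩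
  have hgR : g < R := by linarith
  have hR : 0 < R := hg.trans hgR
  have hq0 : 0 < g / R := div_pos hg hR
  have hq1 : g / R < 1 := (div_lt_one hR).2 hgR
  set r := √(1 - (g / R) ^ 2) with hr
  have hr0 : 0 < r := Real.sqrt_pos.2 (by nlinarith)
  have hr1 : r < 1 := (Real.sqrt_lt' one_pos).2 (by nlinarith)
  have hr2 : r ^ 2 = 1 - (g / R) ^ 2 := Real.sq_sqrt (by nlinarith)
  refine ⟨-Real.log r, neg_pos.2 (Real.log_neg hr0 hr1), 1, one_pos, fun N =>
    ⟨(majorityPolynomial N).comp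
      (Polynomial.C (-(1 / (2 * R))) * Polynomial.X + Polynomial.C (1 / 2 + μ / (2 * R))), ?_, ?_⟩⟩
  · calc _ ≤ N * 1 := Polynomial.natDegree_comp_le.trans
          (Nat.mul_le_mul (natDegree_majorityPolynomial_le N) Polynomial.natDegree_linear_le)
      _ = N := mul_one N
  · intro x hx
    have hexp : (1 : ℝ) * Real.exp (-(-Real.log r * N)) = (2 * (r / 2)) ^ N := by
      rw [one_mul, neg_mul, neg_neg, mul_comm, Real.exp_nat_mul, Real.exp_log hr0,
        mul_div_cancel₀ r two_ne_zero]
    have heval : (Polynomial.C (-(1 / (2 * R))) * Polynomial.X +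
        Polynomial.C (1 / 2 + μ / (2 * R))).eval x = (1 - (x - μ) / R) / 2 := by
      simp only [Polynomial.eval_add, Polynomial.eval_mul, Polynomial.eval_C, Polynomial.eval_X]
      field_simp
      ring
    rw [hexp, Polynomial.eval_comp, heval]
    have hc : 0 ≤ r / 2 := by positivity
    have key : (g / R) ^ 2 ≤ ((x - μ) / R) ^ 2 →
        (1 - (x - μ) / R) / 2 * (1 - (1 - (x - μ) / R) / 2) ≤ (r / 2) ^ 2 := by
      intro h
      nlinarith
    rcases hx with ⟨hx1, hx2⟩ | ⟨hx1, hx2⟩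
    · have hs1 : (x - μ) / R ≤ -(g / R) := by
        rw [← neg_div]
        gcongr
        linarith
      have hs2 : -1 ≤ (x - μ) / R := by
        rw [le_div_iff₀ hR]
        linarith
      rw [if_pos hx2]
      exact abs_one_sub_eval_majorityPolynomial_le (by linarith) (by linarith) hc
        (key (by nlinarith)) N
    · have hs1 : g / R ≤ (x - μ) / R := by
        gcongr
        linarith
      have hs2 : (x - μ) / R ≤ 1 := by
        rw [div_le_one hR]
        linarith
      rw [if_neg (by linarith), zero_sub, abs_neg]
      exact abs_eval_majorityPolynomial_le (by linarith) (by linarith) hc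
        (key (by nlinarith)) N
end

section
/- Let n ≥ 1, let H be a real symmetric n × n matrix with eigenvalues λ_1, …, λ_n and a corresponding orthonormal basis of eigenvectors C^1, …, C^n ∈ ℝ^n. Let F : ℝ → ℝ be differentiable with F′(x) < 0 for all x (in particular strictly decreasing). Define the divided difference D(a, b) := (F(a) − F(b)) / (a − b) for a ≠ b and D(a, a) := F′(a). Then for every nonzero real symmetric n × n matrix Φ, ∑_{s=1}^n ∑_{t=1}^n D(λ_s, λ_t) · ( (C^s)^T Φ C^t )^2 < 0. Consequently, the linear map on symmetric matrices Φ ↦ ∑_{s,t} D(λ_s, λ_t) (C^s (C^s)^T) Φ (C^t (C^t)^T) (the Fréchet derivative DF(H) of the matrix function Φ ↦ F(H) in direction Φ) is negative definite with respect to the Frobenius inner product. -/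
open scoped BigOperators
open Matrix

/-- The divided difference of a function with negative derivative is negative. -/
theorem divided_difference_neg {F : ℝ → ℝ} (hF' : ∀ x, deriv F x < 0) (a b : ℝ) :
    (if a = b then deriv F a else (F a - F b) / (a - b)) < 0 := by
  have hanti : StrictAnti F := strictAnti_of_deriv_neg hF'
  split_ifs with hab
  · exact hF' a
  · rcases lt_or_gt_of_ne hab with h | h
    · exact div_neg_of_pos_of_neg (sub_pos.2 (hanti h)) (sub_neg.2 h)
    · exact div_neg_of_neg_of_pos (sub_neg.2 (hanti h)) (sub_pos.2 h)

/-- A matrix whose coefficients in an orthonormal basis all vanish is zero. -/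
theorem matrix_eq_zero_of_orthonormal_coeff_eq_zero {ι : Type*} [Fintype ι] [DecidableEq ι]
    {C : ι → ι → ℝ} (horth : ∀ s t, C s ⬝ᵥ C t = if s = t then (1 : ℝ) else 0)
    {Φ : Matrix ι ι ℝ} (h : ∀ s t, C s ⬝ᵥ (Φ *ᵥ C t) = 0) : Φ = 0 := by
  let Q : Matrix ι ι ℝ := Matrix.of C
  have hQ : Q * Qᵀ = 1 := by
    ext s t
    rw [Matrix.one_apply]
    exact horth s t
  have hQ' : Qᵀ * Q = 1 := mul_eq_one_comm.1 hQ
  have hz : Q * (Φ * Qᵀ) = 0 := by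
    ext s t
    exact h s t
  calc Φ = (Qᵀ * Q) * Φ * (Qᵀ * Q) := by rw [hQ', one_mul, mul_one]
    _ = Qᵀ * (Q * (Φ * Qᵀ)) * Q := by simp only [mul_assoc]
    _ = 0 := by rw [hz, mul_zero, zero_mul]

/-- Negative definiteness of the derivative of a matrix function with
strictly decreasing scalar `F`.  Let `H` be a real symmetric `n × n` matrix with orthonormal
eigenbasis `C s` and eigenvalues `lam s`, let `F : ℝ → ℝ` be differentiable with `F' < 0`,
and let `D(a,b)` be the divided difference of `F` (with `D(a,a) = F'(a)`).  Then for every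
nonzero symmetric matrix `Φ`:
`∑ s, ∑ t, D(lam s, lam t) * ((C s)ᵀ Φ (C t))² < 0`. -/
theorem divided_difference_quadratic_form_neg (n : ℕ) (hn : 1 ≤ n)
    (H : Matrix (Fin n) (Fin n) ℝ) (hH : H.IsSymm)
    (lam : Fin n → ℝ) (C : Fin n → Fin n → ℝ)
    (horth : ∀ s t, C s ⬝ᵥ C t = if s = t then (1 : ℝ) else 0)
    (heig : ∀ s, H *ᵥ C s = lam s • C s)
    (F : ℝ → ℝ) (hF : Differentiable ℝ F) (hF' : ∀ x, deriv F x < 0)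
    (Φ : Matrix (Fin n) (Fin n) ℝ) (hΦ : Φ.IsSymm) (hΦ0 : Φ ≠ 0) :
    ∑ s, ∑ t,
        (if lam s = lam t then deriv F (lam s)
          else (F (lam s) - F (lam t)) / (lam s - lam t)) * (C s ⬝ᵥ (Φ *ᵥ C t)) ^ 2
      < 0 := by
  have hex : ∃ s t, C s ⬝ᵥ (Φ *ᵥ C t) ≠ 0 := by
    by_contra! h
    exact hΦ0 (matrix_eq_zero_of_orthonormal_coeff_eq_zero horth h)
  obtain ⟨s₀, t₀, h₀⟩ := hex
  have hterm (s t : Fin n) :=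
    mul_nonpos_of_nonpos_of_nonneg (divided_difference_neg hF' (lam s) (lam t)).le
      (sq_nonneg (C s ⬝ᵥ (Φ *ᵥ C t)))
  refine Finset.sum_neg' (fun s _ => Finset.sum_nonpos fun t _ => hterm s t)
    ⟨s₀, Finset.mem_univ _, ?_⟩
  exact Finset.sum_neg' (fun t _ => hterm s₀ t) ⟨t₀, Finset.mem_univ _,
    mul_neg_of_neg_of_pos (divided_difference_neg hF' _ _) (by positivity)⟩
end

section
/- (Hellmann–Feynman.) Let n ≥ 1 and let H : (a, b) → ℝ^{n×n} be a differentiable family of real symmetric matrices. Suppose λ : (a, b) → ℝ and C : (a, b) → ℝ^n are differentiable and satisfy H(t) C(t) = λ(t) C(t) and ‖C(t)‖ = 1 for all t ∈ (a, b), where ‖·‖ is the Euclidean norm. Then for all t ∈ (a, b): λ′(t) = C(t)^T H′(t) C(t). -/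
open Matrix
open scoped BigOperators

/-- Product rule for a matrix-vector product, componentwise. -/
theorem hasDerivAt_mulVec_apply {m n : Type*} [Fintype n] {A : ℝ → Matrix m n ℝ}
    {A' : Matrix m n ℝ} {v : ℝ → n → ℝ} {v' : n → ℝ} {t : ℝ} (i : m)
    (hA : ∀ j, HasDerivAt (fun s => A s i j) (A' i j) t)
    (hv : ∀ j, HasDerivAt (fun s => v s j) (v' j) t) :
    HasDerivAt (fun s => (A s *ᵥ v s) i) ((A' *ᵥ v t + A t *ᵥ v') i) t := by
  have h := HasDerivAt.fun_sum (u := Finset.univ) fun j _ => (hA j).fun_mul (hv j)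
  rw [Finset.sum_add_distrib] at h
  exact h

/-- **Hellmann–Feynman.** Let `H : (a,b) → ℝ^{n×n}` be a differentiable
family of real symmetric matrices (with entrywise derivative `H'`), and let `(lam, C)` be a
differentiable eigenpair with `H t *ᵥ C t = lam t • C t` and `‖C t‖ = 1`
(i.e. `∑ i, (C t i)² = 1`) on `(a,b)`.  Then `lam' t = (C t)ᵀ (H' t) (C t)` on `(a,b)`. -/
theorem hellmann_feynman (n : ℕ) (hn : 1 ≤ n) (a b : ℝ)
    (H H' : ℝ → Matrix (Fin n) (Fin n) ℝ)
    (lam lam' : ℝ → ℝ) (C C' : ℝ → Fin n → ℝ)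
    (hH : ∀ t ∈ Set.Ioo a b, ∀ i j, HasDerivAt (fun s => H s i j) (H' t i j) t)
    (hsym : ∀ t ∈ Set.Ioo a b, (H t).IsSymm)
    (hlam : ∀ t ∈ Set.Ioo a b, HasDerivAt lam (lam' t) t)
    (hC : ∀ t ∈ Set.Ioo a b, ∀ i, HasDerivAt (fun s => C s i) (C' t i) t)
    (heig : ∀ t ∈ Set.Ioo a b, H t *ᵥ C t = lam t • C t)
    (hnorm : ∀ t ∈ Set.Ioo a b, ∑ i, (C t i) ^ 2 = 1) :
    ∀ t ∈ Set.Ioo a b, lam' t = C t ⬝ᵥ (H' t *ᵥ C t) := by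
  intro t ht
  have hderiv : H' t *ᵥ C t + H t *ᵥ C' t = lam' t • C t + lam t • C' t := by
    funext i
    refine (hasDerivAt_mulVec_apply i (hH t ht i) (hC t ht)).unique
      (((hlam t ht).fun_mul (hC t ht i)).congr_of_eventuallyEq ?_)
    filter_upwards [isOpen_Ioo.mem_nhds ht] with s hs
    exact congrFun (heig s hs) i
  have hunit : C t ⬝ᵥ C t = 1 := by
    simpa only [dotProduct, sq] using hnorm t ht
  have hself : C t ⬝ᵥ (H t *ᵥ C' t) = lam t * (C t ⬝ᵥ C' t) := by
    rw [dotProduct_mulVec, ← mulVec_transpose, (hsym t ht).eq, heig t ht, smul_dotProduct,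
      smul_eq_mul]
  have h := congrArg (C t ⬝ᵥ ·) hderiv
  simp only [dotProduct_add, dotProduct_smul, smul_eq_mul, hunit, hself] at h
  linarith
end

section
/- Let n ≥ 1 and let k be a natural number with 0 ≤ k ≤ n. Define K := { γ ∈ ℝ^{n×n} : γ^T = γ, 0 ≤ γ ≤ I, trace(γ) = k }, where 0 ≤ γ ≤ I means that both γ and I − γ are positive semi-definite. Then K is convex and compact, and K equals the convex hull of the set P := { γ ∈ ℝ^{n×n} : γ^T = γ, γ² = γ, trace(γ) = k } of rank-k orthogonal projections. -/
open Finset in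
/-- A point of the hypersimplex is a convex combination of the `0`-`1` vectors in it. -/
theorem mem_convexHull_zero_one_of_sum_eq_natCast {ι : Type*} [Fintype ι] {k : ℕ} (x : ι → ℝ)
    (h0 : ∀ i, 0 ≤ x i) (h1 : ∀ i, x i ≤ 1) (hsum : ∑ i, x i = k) :
    x ∈ convexHull ℝ {y : ι → ℝ | (∀ i, y i = 0 ∨ y i = 1) ∧ ∑ i, y i = k} := by
  classical
  induction hm : #{i | x i ≠ 0 ∧ x i ≠ 1} using Nat.strong_induction_on generalizing x with
  | _ m ih =>
  subst hm
  by_cases hx : ∀ i, x i = 0 ∨ x i = 1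
  · exact subset_convexHull ℝ _ ⟨hx, hsum⟩
  push Not at hx
  obtain ⟨i, hi0, hi1⟩ := hx
  obtain ⟨j, hji, hj0, hj1⟩ : ∃ j, j ≠ i ∧ x j ≠ 0 ∧ x j ≠ 1 := by
    by_contra! h
    have hint : ∑ j ∈ univ.erase i, x j = (#{j ∈ univ.erase i | x j = 1} : ℕ) := by
      rw [card_filter, Nat.cast_sum]
      refine sum_congr rfl fun j hj => ?_
      by_cases hj0 : x j = 0
      · simp [hj0]
      · simp [h j (ne_of_mem_erase hj) hj0]
    rw [← add_sum_erase _ _ (mem_univ i), hint] at hsum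
    have hpos : 0 < x i := lt_of_le_of_ne (h0 i) hi0.symm
    have hlt : x i < 1 := lt_of_le_of_ne (h1 i) hi1
    set c := #{j ∈ univ.erase i | x j = 1}
    have hck : c < k := by exact_mod_cast (by linarith : (c : ℝ) < k)
    have hkc : k < c + 1 := by exact_mod_cast (by linarith : (k : ℝ) < c + 1)
    omega
  have hip : 0 < x i := lt_of_le_of_ne (h0 i) hi0.symm
  have hil : x i < 1 := lt_of_le_of_ne (h1 i) hi1
  have hjp : 0 < x j := lt_of_le_of_ne (h0 j) hj0.symm
  have hjl : x j < 1 := lt_of_le_of_ne (h1 j) hj1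
  have shift : ∀ t : ℝ, 0 ≤ x i + t → x i + t ≤ 1 → 0 ≤ x j - t → x j - t ≤ 1 →
      (x i + t = 0 ∨ x i + t = 1 ∨ x j - t = 0 ∨ x j - t = 1) →
      x + t • (Pi.single i 1 - Pi.single j 1) ∈
        convexHull ℝ {y : ι → ℝ | (∀ i, y i = 0 ∨ y i = 1) ∧ ∑ i, y i = k} := by
    intro t hi0' hi1' hj0' hj1' hend
    set y := x + t • (Pi.single i 1 - Pi.single j 1 : ι → ℝ) with hy
    have hyi : y i = x i + t := by simp [hy, hji]
    have hyj : y j = x j - t := by simp [hy, hji, sub_eq_add_neg]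
    have hyl : ∀ l, l ≠ i → l ≠ j → y l = x l := by
      intro l hli hlj
      simp [hy, hli, hlj]
    have hall : ∀ l, 0 ≤ y l ∧ y l ≤ 1 := by
      intro l
      by_cases hli : l = i
      · subst hli; rw [hyi]; exact ⟨hi0', hi1'⟩
      by_cases hlj : l = j
      · subst hlj; rw [hyj]; exact ⟨hj0', hj1'⟩
      rw [hyl l hli hlj]; exact ⟨h0 l, h1 l⟩
    refine ih _ (card_lt_card ?_) y (fun l => (hall l).1) (fun l => (hall l).2) ?_ rfl
    · refine (ssubset_iff_of_subset ?_).2 ?_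
      · intro l hl
        by_cases hli : l = i
        · subst hli; simp [hi0, hi1]
        by_cases hlj : l = j
        · subst hlj; simp [hj0, hj1]
        simpa [hyl l hli hlj] using hl
      · rw [← hyi, ← hyj] at hend
        by_cases hyi' : y i = 0 ∨ y i = 1
        · exact ⟨i, by simp [hi0, hi1], by simp; tauto⟩
        · exact ⟨j, by simp [hj0, hj1], by simp; tauto⟩
    · simp [hy, sum_add_distrib, ← mul_sum, hsum]
  set a := min (x i) (1 - x j) with ha
  set b := min (1 - x i) (x j) with hb
  have hapos : 0 < a := lt_min hip (by linarith)
  have hbpos : 0 < b := lt_min (by linarith) hjp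
  have ha1 : a ≤ x i := min_le_left _ _
  have ha2 : a ≤ 1 - x j := min_le_right _ _
  have hb1 : b ≤ 1 - x i := min_le_left _ _
  have hb2 : b ≤ x j := min_le_right _ _
  have hup := shift b (by linarith) (by linarith) (by linarith) (by linarith) (by
    rcases min_choice (1 - x i) (x j) with h | h
    · right; left; rw [hb, h]; ring
    · right; right; left; rw [hb, h]; ring)
  have hdown := shift (-a) (by linarith) (by linarith) (by linarith) (by linarith) (by
    rcases min_choice (x i) (1 - x j) with h | h
    · left; rw [ha, h]; ring
    · right; right; right; rw [ha, h]; ring)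
  have hcomb := convex_convexHull ℝ _ hup hdown (a := a / (a + b)) (b := b / (a + b))
    (by positivity) (by positivity) (by field_simp)
  convert hcomb using 1
  ext l
  simp only [Pi.add_apply, Pi.smul_apply, smul_eq_mul]
  field_simp
  ring

namespace Matrix

variable {ι : Type*}

theorem isClosed_setOf_posSemidef [Fintype ι] :
    IsClosed {A : Matrix ι ι ℝ | A.PosSemidef} := by
  simp only [posSemidef_iff_dotProduct_mulVec, IsHermitian, Set.ofPred_and, Set.ofPred_forall]
  refine (isClosed_eq (by fun_prop) (by fun_prop)).inter (isClosed_iInter fun x => ?_)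
  exact isClosed_le (by fun_prop) (by fun_prop)

theorem PosSemidef.two_mul_abs_apply_le [Fintype ι] {A : Matrix ι ι ℝ} (hA : A.PosSemidef)
    (i j : ι) : 2 * |A i j| ≤ A i i + A j j := by
  classical
  have hsymm : A j i = A i j := by simpa using hA.isHermitian.apply i j
  have hadd := hA.dotProduct_mulVec_nonneg (Pi.single i 1 + Pi.single j 1)
  have hsub := hA.dotProduct_mulVec_nonneg (Pi.single i 1 - Pi.single j 1)
  simp [mulVec_add, mulVec_sub, hsymm] at hadd hsub
  rcases abs_cases (A i j) with h | h <;> linarith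

theorem posSemidef_of_isSymm_of_mul_self [Fintype ι] {A : Matrix ι ι ℝ} (hs : A.IsSymm)
    (hA : A * A = A) : A.PosSemidef := by
  have h := posSemidef_conjTranspose_mul_self A
  rwa [conjTranspose_eq_transpose_of_trivial, hs.eq, hA] at h

variable [Fintype ι] [DecidableEq ι]

theorem convex_setOf_posSemidef_le_one_trace_eq (c : ℝ) :
    Convex ℝ {A : Matrix ι ι ℝ |
      A.IsSymm ∧ A.PosSemidef ∧ (1 - A).PosSemidef ∧ A.trace = c} := by
  rintro A ⟨hAs, hA0, hA1, hAt⟩ B ⟨hBs, hB0, hB1, hBt⟩ a b ha hb hab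
  refine ⟨(hAs.smul a).add (hBs.smul b), (hA0.smul ha).add (hB0.smul hb), ?_, ?_⟩
  · have h : 1 - (a • A + b • B) = a • (1 - A) + b • (1 - B) := by
      rw [smul_sub, smul_sub, sub_add_sub_comm, ← add_smul, hab, one_smul]
    rw [h]
    exact (hA1.smul ha).add (hB1.smul hb)
  · simp [hAt, hBt, ← add_mul, hab]

theorem isCompact_setOf_posSemidef_le_one_trace_eq (c : ℝ) :
    IsCompact {A : Matrix ι ι ℝ |
      A.IsSymm ∧ A.PosSemidef ∧ (1 - A).PosSemidef ∧ A.trace = c} := by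
  have hbox : IsCompact (X := Matrix ι ι ℝ)
      (Set.univ.pi fun _ => Set.univ.pi fun _ => Set.Icc (-1) 1) :=
    isCompact_univ_pi fun _ => isCompact_univ_pi fun _ => isCompact_Icc
  refine hbox.of_isClosed_subset ?_ ?_
  · exact (isClosed_eq (by fun_prop) (by fun_prop)).inter <|
      isClosed_setOf_posSemidef.inter <|
      (isClosed_setOf_posSemidef.preimage (f := fun A : Matrix ι ι ℝ => 1 - A)
        (by fun_prop)).inter <| isClosed_eq (by fun_prop) (by fun_prop)
  · rintro (A : Matrix ι ι ℝ) ⟨-, hA0, hA1, -⟩ i - j -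
    have hdiag : ∀ l, A l l ≤ 1 := fun l => by simpa using hA1.diag_nonneg (i := l)
    exact abs_le.1 (by linarith [hA0.two_mul_abs_apply_le i j, hdiag i, hdiag j])

theorem mem_convexHull_projections {k : ℕ} {A : Matrix ι ι ℝ} (hA0 : A.PosSemidef)
    (hA1 : (1 - A).PosSemidef) (htr : A.trace = k) :
    A ∈ convexHull ℝ {B : Matrix ι ι ℝ | B.IsSymm ∧ B * B = B ∧ B.trace = (k : ℝ)} := by
  have hA := hA0.isHermitian
  set U : Matrix ι ι ℝ := hA.eigenvectorUnitary.1
  have hUU : star U * U = 1 := Unitary.coe_star_mul_self hA.eigenvectorUnitary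
  have hspec : A = U * diagonal hA.eigenvalues * star U := by
    simpa [Unitary.conjStarAlgAut_apply] using hA.spectral_theorem
  have hdiag : star U * A * U = diagonal hA.eigenvalues := by
    conv_lhs => rw [hspec]
    simp only [Matrix.mul_assoc, hUU, Matrix.mul_one]
    rw [← Matrix.mul_assoc, hUU, Matrix.one_mul]
  have hle : ∀ i, hA.eigenvalues i ≤ 1 := by
    have h := hA1.conjTranspose_mul_mul_same U
    rw [← star_eq_conjTranspose, Matrix.mul_sub, Matrix.mul_one, Matrix.sub_mul, hUU, hdiag,
      ← diagonal_one, diagonal_sub, posSemidef_diagonal_iff] at h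
    exact fun i => sub_nonneg.1 (h i)
  have hmem := mem_convexHull_zero_one_of_sum_eq_natCast (k := k) hA.eigenvalues
    hA0.eigenvalues_nonneg hle (by rw [← htr, hA.trace_eq_sum_eigenvalues]; simp)
  let L : (ι → ℝ) →ₗ[ℝ] Matrix ι ι ℝ :=
    LinearMap.mulRight ℝ (star U) ∘ₗ LinearMap.mulLeft ℝ U ∘ₗ diagonalLinearMap ι ℝ ℝ
  have hL : ∀ d, L d = U * diagonal d * star U := fun _ => rfl
  have himg := Set.mem_image_of_mem L hmem
  rw [L.image_convexHull, hL, ← hspec] at himg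
  refine convexHull_mono ?_ himg
  rintro _ ⟨d, ⟨hd, hsum⟩, rfl⟩
  rw [hL]
  refine ⟨?_, ?_, ?_⟩
  · simp [IsSymm, star_eq_conjTranspose, conjTranspose_eq_transpose_of_trivial, Matrix.mul_assoc]
  · have hdd : diagonal d * diagonal d = diagonal d := by
      rw [diagonal_mul_diagonal]
      congr 1
      ext i
      rcases hd i with h | h <;> simp [h]
    calc U * diagonal d * star U * (U * diagonal d * star U)
        = U * diagonal d * (star U * U) * diagonal d * star U := by simp only [Matrix.mul_assoc]
      _ = U * (diagonal d * diagonal d) * star U := by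
        rw [hUU, Matrix.mul_one, Matrix.mul_assoc U]
      _ = U * diagonal d * star U := by rw [hdd]
  · rw [trace_mul_comm, ← Matrix.mul_assoc, hUU, Matrix.one_mul, trace_diagonal, hsum]

end Matrix


/-- For `1 ≤ n` and `k ≤ n`, the set
`K = {γ ∈ ℝ^{n×n} : γᵀ = γ, 0 ≤ γ ≤ I, trace γ = k}` of fractional-occupation density
matrices is convex and compact, and equals the convex hull of the set
`P = {γ : γᵀ = γ, γ² = γ, trace γ = k}` of rank-`k` orthogonal projections. -/
theorem density_matrices_convexHull (n k : ℕ) (hn : 1 ≤ n) (hk : k ≤ n)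
    (K P : Set (Matrix (Fin n) (Fin n) ℝ))
    (hK : K = {γ : Matrix (Fin n) (Fin n) ℝ |
      γ.IsSymm ∧ γ.PosSemidef ∧ (1 - γ).PosSemidef ∧ γ.trace = (k : ℝ)})
    (hP : P = {γ : Matrix (Fin n) (Fin n) ℝ |
      γ.IsSymm ∧ γ * γ = γ ∧ γ.trace = (k : ℝ)}) :
    Convex ℝ K ∧ IsCompact K ∧ K = convexHull ℝ P := by
  subst hK hP
  have hconv := Matrix.convex_setOf_posSemidef_le_one_trace_eq (ι := Fin n) k
  refine ⟨hconv, Matrix.isCompact_setOf_posSemidef_le_one_trace_eq (k : ℝ), ?_⟩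
  refine Set.Subset.antisymm ?_ (convexHull_min ?_ hconv)
  · rintro γ ⟨-, h0, h1, htr⟩
    exact Matrix.mem_convexHull_projections h0 h1 htr
  · rintro γ ⟨hs, hγ, htr⟩
    refine ⟨hs, Matrix.posSemidef_of_isSymm_of_mul_self hs hγ,
      Matrix.posSemidef_of_isSymm_of_mul_self (Matrix.isSymm_one.sub hs) ?_, htr⟩
    simp [Matrix.sub_mul, Matrix.mul_sub, hγ]
end

section
/- Let 𝔪 > 0, N_b ≥ 1, and let φ_1, …, φ_{N_b} : ℝ^3 → ℝ satisfy |φ_a(x)| ≤ c_φ e^{−η_φ |x|} for all x and some c_φ, η_φ > 0. Then there exist constants η > 0 and C > 0 (depending only on 𝔪, N_b, c_φ, η_φ and the decay rate η_0 below) such that: for any points r_1, …, r_M ∈ ℝ^3 with min_{ℓ≠k} |r_ℓ − r_k| ≥ 𝔪 and any real block matrix γ with |γ_{ℓk,ab}| ≤ c_0 e^{−η_0 |r_ℓ − r_k|} for all ℓ, k, a, b (some c_0, η_0 > 0), the function ρ(x) := ∑_{ℓ,k=1}^M ∑_{a,b=1}^{N_b} φ_a(x − r_ℓ) γ_{ℓk,ab}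 φ_b(x − r_k) satisfies |ρ(x)| ≤ C c_0 e^{−η · min_{1≤ℓ≤M} |x − r_ℓ|} for all x ∈ ℝ^3. -/
open scoped BigOperators

open MeasureTheory in
theorem integrable_exp_neg_mul_norm_s18 {E : Type*} [NormedAddCommGroup E] [NormedSpace ℝ E]
    [FiniteDimensional ℝ E] [MeasurableSpace E] [BorelSpace E] (μ : Measure E)
    [μ.IsAddHaarMeasure] {α : ℝ} (hα : 0 < α) :
    Integrable (fun x : E ↦ Real.exp (-(α * ‖x‖))) μ := by
  set n := Module.finrank ℝ E + 1 with hn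
  have hint : Integrable (fun x : E ↦ (1 + ‖x‖) ^ (-(n : ℝ))) μ :=
    integrable_one_add_norm (by rw [hn]; push_cast; linarith)
  refine (hint.const_mul (n.factorial / α ^ n * Real.exp α)).mono'
    (by fun_prop) (.of_forall fun x ↦ ?_)
  have h1 : 0 < 1 + ‖x‖ := by positivity
  have h := Real.pow_div_factorial_le_exp (α * (1 + ‖x‖)) (by positivity) n
  have h2 : Real.exp (α * (1 + ‖x‖)) = Real.exp α * Real.exp (α * ‖x‖) := by
    rw [← Real.exp_add]; ring_nf
  rw [h2, div_le_iff₀ (by positivity), mul_pow] at h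
  rw [Real.norm_eq_abs, Real.abs_exp, Real.rpow_neg h1.le, Real.rpow_natCast, Real.exp_neg,
    inv_le_iff_one_le_mul₀ (by positivity)]
  field_simp
  rw [mul_comm α ‖x‖] at h
  linarith

open MeasureTheory in
/-- The sum of a decaying exponential over a separated family of points is bounded uniformly in
the family and in the base point. -/
theorem exists_sum_exp_neg_mul_norm_sub_le {E : Type*} [NormedAddCommGroup E] [NormedSpace ℝ E]
    [FiniteDimensional ℝ E] {δ α : ℝ} (hδ : 0 < δ) (hα : 0 < α) :
    ∃ K > (0 : ℝ), ∀ {ι : Type} [Fintype ι] (r : ι → E),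
      (∀ i j, i ≠ j → δ ≤ ‖r i - r j‖) →
      ∀ x, ∑ i, Real.exp (-(α * ‖x - r i‖)) ≤ K := by
  borelize E
  let μ : Measure E := Measure.addHaar
  set v := μ.real (Metric.ball (0 : E) (δ / 2)) with hv
  have hv0 : 0 < v :=
    ENNReal.toReal_pos (Metric.measure_ball_pos μ 0 (by positivity)).ne' measure_ball_lt_top.ne
  set I := ∫ y : E, Real.exp (-(α * ‖y‖)) ∂μ with hI
  have hI0 : 0 ≤ I := integral_nonneg fun y ↦ (Real.exp_pos _).le
  refine ⟨Real.exp (α * (δ / 2)) * I / v + 1, by positivity, fun {ι} _ r hr x ↦ ?_⟩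
  set f : E → ℝ := fun y ↦ Real.exp (-(α * ‖x - y‖)) with hf
  have hfint : Integrable f μ := (integrable_exp_neg_mul_norm_s18 μ hα).comp_sub_left x
  have hdisj : Pairwise (Function.onFun Disjoint fun i ↦ Metric.ball (r i) (δ / 2)) :=
    fun i j hij ↦ Metric.ball_disjoint_ball (by
      rw [dist_eq_norm]; linarith [hr i j hij])
  have hball : ∀ i, v * f (r i) ≤
      Real.exp (α * (δ / 2)) * ∫ y in Metric.ball (r i) (δ / 2), f y ∂μ := by
    intro i
    have hvi : v = μ.real (Metric.ball (r i) (δ / 2)) := by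
      simp only [hv, measureReal_def, Measure.addHaar_ball_center]
    rw [hvi, ← smul_eq_mul, ← setIntegral_const, ← integral_const_mul]
    refine setIntegral_mono_on (integrableOn_const measure_ball_lt_top.ne)
      (hfint.integrableOn.const_mul _) measurableSet_ball fun y hy ↦ ?_
    simp only [hf]
    rw [← Real.exp_add, Real.exp_le_exp]
    have h1 : ‖y - r i‖ < δ / 2 := by simpa [dist_eq_norm] using hy
    have h2 : ‖x - y‖ ≤ ‖x - r i‖ + ‖y - r i‖ := by
      simpa using norm_sub_le (x - r i) (y - r i)
    nlinarith
  have hsum : ∑ i, ∫ y in Metric.ball (r i) (δ / 2), f y ∂μ ≤ I := by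
    rw [← integral_iUnion_fintype (fun i ↦ measurableSet_ball) hdisj
      fun i ↦ hfint.integrableOn]
    refine (setIntegral_le_integral hfint (.of_forall fun y ↦ (Real.exp_pos _).le)).trans_eq ?_
    exact integral_sub_left_eq_self (fun y ↦ Real.exp (-(α * ‖y‖))) μ x
  have hle : v * ∑ i, f (r i) ≤ Real.exp (α * (δ / 2)) * I := by
    rw [Finset.mul_sum]
    refine (Finset.sum_le_sum fun i _ ↦ hball i).trans ?_
    rw [← Finset.mul_sum]
    gcongr
  have : ∑ i, f (r i) ≤ Real.exp (α * (δ / 2)) * I / v := by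
    rw [le_div_iff₀ hv0]; linarith
  linarith



/-- Exponential localisation of the electron density
`ρ(x) = ∑_{ℓ,k,a,b} φ_a(x − r ℓ) γ_{ℓk,ab} φ_b(x − r k)` built from exponentially localised
orbitals `φ_a` and an exponentially decaying block density matrix `γ`:
`|ρ(x)| ≤ C c₀ exp(−η minₗ ‖x − r ℓ‖)`, with `η, C` independent of the configuration and
of `γ`. -/
theorem density_exponentially_localised (N_b : ℕ) (hNb : 1 ≤ N_b)
    (𝔪 cφ ηφ η₀ : ℝ) (h𝔪 : 0 < 𝔪) (hcφ : 0 < cφ) (hηφ : 0 < ηφ) (hη₀ : 0 < η₀)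
    (φ : Fin N_b → EuclideanSpace ℝ (Fin 3) → ℝ)
    (hφ : ∀ a x, |φ a x| ≤ cφ * Real.exp (-(ηφ * ‖x‖))) :
    ∃ η > (0 : ℝ), ∃ C > (0 : ℝ), ∀ (M : ℕ), 1 ≤ M →
      ∀ (r : Fin M → EuclideanSpace ℝ (Fin 3)),
        (∀ i j, i ≠ j → 𝔪 ≤ ‖r i - r j‖) →
        ∀ (c₀ : ℝ), 0 < c₀ →
        ∀ (γ : Matrix (Fin M × Fin N_b) (Fin M × Fin N_b) ℝ),
          (∀ ℓ k a b, |γ (ℓ, a) (k, b)| ≤ c₀ * Real.exp (-(η₀ * ‖r ℓ - r k‖))) →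
          ∀ x : EuclideanSpace ℝ (Fin 3),
            |∑ ℓ, ∑ k, ∑ a, ∑ b, φ a (x - r ℓ) * γ (ℓ, a) (k, b) * φ b (x - r k)|
              ≤ C * c₀ * Real.exp (-(η * ⨅ ℓ, ‖x - r ℓ‖)) := by
  obtain ⟨K, hK, hKle⟩ := exists_sum_exp_neg_mul_norm_sub_le
    (E := EuclideanSpace ℝ (Fin 3)) h𝔪 (half_pos hηφ)
  have hN : (0 : ℝ) < N_b := by exact_mod_cast hNb
  refine ⟨ηφ, hηφ, (N_b * cφ * K) ^ 2, by positivity, ?_⟩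
  intro M _ r hr c₀ hc₀ γ hγ x
  set d := ⨅ ℓ, ‖x - r ℓ‖ with hd
  set e : Fin M → ℝ := fun ℓ ↦ Real.exp (-(ηφ * ‖x - r ℓ‖)) with he
  have hγ' : ∀ ℓ k a b, |γ (ℓ, a) (k, b)| ≤ c₀ := fun ℓ k a b ↦ (hγ ℓ k a b).trans <|
    mul_le_of_le_one_right hc₀.le <| Real.exp_le_one_iff.2 <| neg_nonpos.2 <| by positivity
  have he_sum : ∑ ℓ, e ℓ ≤ K * Real.exp (-(ηφ / 2 * d)) := by
    calc ∑ ℓ, e ℓ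
        ≤ ∑ ℓ, Real.exp (-(ηφ / 2 * ‖x - r ℓ‖)) * Real.exp (-(ηφ / 2 * d)) := by
          refine Finset.sum_le_sum fun ℓ _ ↦ ?_
          rw [he, ← Real.exp_add, Real.exp_le_exp]
          have : d ≤ ‖x - r ℓ‖ := ciInf_le (Set.finite_range _).bddBelow ℓ
          nlinarith
      _ ≤ K * Real.exp (-(ηφ / 2 * d)) := by
          rw [← Finset.sum_mul]
          gcongr
          exact hKle r hr x
  calc |∑ ℓ, ∑ k, ∑ a, ∑ b, φ a (x - r ℓ) * γ (ℓ, a) (k, b) * φ b (x - r k)|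
      ≤ ∑ ℓ, ∑ k, ∑ _a : Fin N_b, ∑ _b : Fin N_b, (cφ * e ℓ) * c₀ * (cφ * e k) := by
        refine (Finset.abs_sum_le_sum_abs _ _).trans (Finset.sum_le_sum fun ℓ _ ↦ ?_)
        refine (Finset.abs_sum_le_sum_abs _ _).trans (Finset.sum_le_sum fun k _ ↦ ?_)
        refine (Finset.abs_sum_le_sum_abs _ _).trans (Finset.sum_le_sum fun a _ ↦ ?_)
        refine (Finset.abs_sum_le_sum_abs _ _).trans (Finset.sum_le_sum fun b _ ↦ ?_)
        rw [abs_mul, abs_mul]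
        gcongr
        exacts [hφ _ _, hγ' _ _ _ _, hφ _ _]
    _ = (N_b * cφ) ^ 2 * c₀ * (∑ ℓ, e ℓ) ^ 2 := by
        rw [sq (∑ ℓ, e ℓ), Finset.sum_mul_sum, Finset.mul_sum]
        refine Finset.sum_congr rfl fun ℓ _ ↦ ?_
        rw [Finset.mul_sum]
        refine Finset.sum_congr rfl fun k _ ↦ ?_
        simp only [Finset.sum_const, Finset.card_univ, Fintype.card_fin, nsmul_eq_mul]
        ring
    _ ≤ (N_b * cφ) ^ 2 * c₀ * (K * Real.exp (-(ηφ / 2 * d))) ^ 2 := by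
        gcongr
    _ = (N_b * cφ * K) ^ 2 * c₀ * Real.exp (-(ηφ * d)) := by
        rw [mul_pow K, ← Real.exp_nat_mul]
        push_cast
        rw [show (2 : ℝ) * -(ηφ / 2 * d) = -(ηφ * d) by ring]
        ring
end
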